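/- Let {j_1,…,j_t} ⊆ {1,…,n}, (a_1,…,a_t) ∈ ℕ^t, let I ⊆ K{y_1,…,y_n} be a pure binomial σ-ideal, and let h ∈ N^{a_1…a_t}_{j_1…j_t}(I). Then there exist a pure binomial σ-ideal I' ⊇ [I ∪ {h}], l ∈ ℕ, and pairs (p_k, b_k) for 1 ≤ k ≤ l, with either p_k ∉ {j_1,…,j_t}, or p_k = j_m and b_k < a_m for some m, such that ⟨I ∪ {y_{j_1}^{x^{a_1}},…,y_{j_t}^{x^{a_t}}}⟩_r = ⟨I' ∪ {y_{j_1}^{x^{a_1}},…,y_{j_t}^{x^{a_t}}}⟩_r ∩ ⋂_{1≤k≤l} ⟨I ∪ {y_{j_1}^{x^{a_1}},…,y_{j_t}^{x^{a_t}}, y_{p_k}^{x^{b_k}}}⟩_r. -/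

import Mathlib

open Polynomial

section SigmaRing

variable {R : Type*} [CommRing R]

/-- A σ-ideal: an ideal closed under the difference operator σ. -/
def IsSigmaIdeal (σ : R →+* R) (I : Ideal R) : Prop := ∀ a ∈ I, σ a ∈ I

/-- A σ-ideal is well-mixed if `a * b ∈ I` implies `a * σ b ∈ I`. -/
def IsWellMixed (σ : R →+* R) (I : Ideal R) : Prop := ∀ a b : R, a * b ∈ I → a * σ b ∈ I

/-- `[F]`, the smallest σ-ideal containing `F`. -/
def sigmaIdealGen (σ : R →+* R) (F : Set R) : Ideal R :=
  sInf {I : Ideal R | F ⊆ I ∧ IsSigmaIdeal σ I}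

/-- `⟨F⟩`, the smallest well-mixed σ-ideal containing `F` (well-mixed closure). -/
def wmClosure (σ : R →+* R) (F : Set R) : Ideal R :=
  sInf {I : Ideal R | F ⊆ I ∧ IsSigmaIdeal σ I ∧ IsWellMixed σ I}

/-- `⟨F⟩_r`, the smallest radical well-mixed σ-ideal containing `F`. -/
def rwmClosure (σ : R →+* R) (F : Set R) : Ideal R :=
  sInf {I : Ideal R | F ⊆ I ∧ IsSigmaIdeal σ I ∧ IsWellMixed σ I ∧ I.IsRadical}

/-- Symbolic exponent: for `p = Σ c_i x^i ∈ ℕ[x]`, `a^p = Π (σ^i a)^(c_i)`. -/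
noncomputable def sexp (σ : R →+* R) (a : R) (p : Polynomial ℕ) : R :=
  ∏ i ∈ Finset.range (p.natDegree + 1), ((⇑σ)^[i] a) ^ (p.coeff i)

/-- `I` is finitely generated as a radical well-mixed σ-ideal. -/
def FinGenAsRWM (σ : R →+* R) (I : Ideal R) : Prop :=
  ∃ G : Set R, G.Finite ∧ G ⊆ (I : Set R) ∧ I = rwmClosure σ G

/-- σ-prime: a reflexive σ-ideal which is prime. -/
def IsSigmaPrime (σ : R →+* R) (I : Ideal R) : Prop :=
  IsSigmaIdeal σ I ∧ (∀ a : R, σ a ∈ I → a ∈ I) ∧ I.IsPrime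

end SigmaRing

/-- The σ-polynomial ring `K{y_1,…,y_n}`: polynomials in variables `y_i^{x^j}`,
indexed by pairs `(i, j) ∈ Fin n × ℕ`. -/
abbrev DPoly (K : Type*) [Field K] (n : ℕ) := MvPolynomial (Fin n × ℕ) K

section DPoly

variable {K : Type*} [Field K] {n : ℕ} (σK : K →+* K)

/-- The difference operator on `K{y_1,…,y_n}` extending `σK`, with `σ(y_i^{x^j}) = y_i^{x^{j+1}}`. -/
noncomputable def shift : DPoly K n →+* DPoly K n :=
  MvPolynomial.eval₂Hom ((MvPolynomial.C : K →+* DPoly K n).comp σK)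
    (fun v => MvPolynomial.X (v.1, v.2 + 1))

/-- `y_i^p` for `p ∈ ℕ[x]`. -/
noncomputable def ypow (i : Fin n) (p : Polynomial ℕ) : DPoly K n :=
  sexp (shift σK) (MvPolynomial.X (i, 0)) p

/-- `y_i^{x^a}`. -/
noncomputable def varPow (i : Fin n) (a : ℕ) : DPoly K n :=
  ypow σK i (Polynomial.X ^ a)

/-- The monomial `Y^f = Π y_i^{f_i}` for `f ∈ ℕ[x]^n`. -/
noncomputable def monom (f : Fin n → Polynomial ℕ) : DPoly K n :=
  ∏ i, ypow σK i (f i)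

/-- A pure binomial `Y^f − Y^g`. -/
def IsPureBinomial (p : DPoly K n) : Prop :=
  ∃ f g : Fin n → Polynomial ℕ, p = monom σK f - monom σK g

/-- A binomial `a·Y^f + b·Y^g` with `a, b ∈ K^×`. -/
def IsBinomial (p : DPoly K n) : Prop :=
  ∃ (a b : K) (f g : Fin n → Polynomial ℕ), a ≠ 0 ∧ b ≠ 0 ∧
    p = MvPolynomial.C a * monom σK f + MvPolynomial.C b * monom σK g

/-- A pure binomial σ-ideal: a σ-ideal generated by pure binomials. -/
def IsPureBinomialSigmaIdeal (I : Ideal (DPoly K n)) : Prop :=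
  ∃ S : Set (DPoly K n), (∀ p ∈ S, IsPureBinomial σK p) ∧ I = sigmaIdealGen (shift σK) S

/-- Positive part of `f ∈ ℤ[x]`. -/
noncomputable def posPart (f : Polynomial ℤ) : Polynomial ℕ :=
  f.sum fun i c => Polynomial.monomial i c.toNat

/-- Negative part of `f ∈ ℤ[x]`. -/
noncomputable def negPart (f : Polynomial ℤ) : Polynomial ℕ :=
  f.sum fun i c => Polynomial.monomial i (-c).toNat

/-- The lattice σ-ideal `I_L = [Y^{f_+} − Y^{f_−} : f ∈ L]` of a ℤ[x]-lattice `L ⊆ ℤ[x]^n`. -/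
noncomputable def latticeIdeal (L : Submodule (Polynomial ℤ) (Fin n → Polynomial ℤ)) :
    Ideal (DPoly K n) :=
  sigmaIdealGen (shift σK)
    {p | ∃ f ∈ L, p = monom σK (fun i => posPart (f i)) - monom σK (fun i => negPart (f i))}

end DPoly

/-- `𝔪`: the multiplicatively closed set generated by the variables `y_i^{x^j}`. -/
def mSet (K : Type*) [Field K] (n : ℕ) : Set (DPoly K n) :=
  (Submonoid.closure (Set.range fun v : Fin n × ℕ => (MvPolynomial.X v : DPoly K n)) : Set _)

/-- `I : 𝔪 = {p : M p ∈ I for some M ∈ 𝔪}`. -/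
def colonM {K : Type*} [Field K] {n : ℕ} (I : Ideal (DPoly K n)) : Set (DPoly K n) :=
  {p | ∃ M ∈ mSet K n, M * p ∈ I}

section Tsec

variable {K : Type*} [Field K] {n t : ℕ} (σK : K →+* K)

/-- The set `T^{a_1…a_t}_{j_1…j_t}` of monomials `Y^f` with `deg f_{j_i} < a_i`. -/
def Tset (j : Fin t → Fin n) (a : Fin t → ℕ) : Set (DPoly K n) :=
  {p | ∃ f : Fin n → Polynomial ℕ,
    (∀ i : Fin t, (f (j i)).degree < (a i : WithBot ℕ)) ∧ p = monom σK f}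

/-- `I` is saturated with respect to `{y_{j_1}^{x^{a_1}},…,y_{j_t}^{x^{a_t}}}`. -/
def SaturatedWrt (j : Fin t → Fin n) (a : Fin t → ℕ) (I : Ideal (DPoly K n)) : Prop :=
  ∀ g M : DPoly K n, M ∈ Tset σK j a → M * g ∈ I → g ∈ I

/-- `J : T = {g : M g ∈ J for some M ∈ T}`. -/
def colonT (j : Fin t → Fin n) (a : Fin t → ℕ) (J : Ideal (DPoly K n)) : Set (DPoly K n) :=
  {g | ∃ M ∈ Tset σK j a, M * g ∈ J}

/-- The `T`-saturated closure `N^{a_1…a_t}_{j_1…j_t}(I)`: the smallest saturated σ-ideal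
containing `I`. -/
noncomputable def Nclosure (j : Fin t → Fin n) (a : Fin t → ℕ) (I : Ideal (DPoly K n)) :
    Ideal (DPoly K n) :=
  sInf {J : Ideal (DPoly K n) | I ≤ J ∧ IsSigmaIdeal (shift σK) J ∧ SaturatedWrt σK j a J}

/-- The set of variables `{y_{j_1}^{x^{a_1}},…,y_{j_t}^{x^{a_t}}}`. -/
noncomputable def varSet (j : Fin t → Fin n) (a : Fin t → ℕ) : Set (DPoly K n) :=
  Set.range fun i => varPow σK (j i) (a i)

/-- `⟨I₀ ∪ {y_{j_1}^{x^{a_1}},…,y_{j_t}^{x^{a_t}}}⟩_r` is quasi-normal. -/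
def QuasiNormal (j : Fin t → Fin n) (a : Fin t → ℕ) (I0 : Ideal (DPoly K n)) : Prop :=
  SaturatedWrt σK j a I0 ∧
  ∀ f g : Fin n → Polynomial ℕ, monom σK f - monom σK g ∈ I0 →
    monom σK f ∈ sigmaIdealGen (shift σK) (varSet σK j a) →
    monom σK g ∈ sigmaIdealGen (shift σK) (varSet σK j a)

end Tsec

section RadicalWellMixed

variable {R : Type*} [CommRing R] (σ : R →+* R)

lemma subset_sigmaIdealGen (F : Set R) : F ⊆ sigmaIdealGen σ F := fun _ hx =>
  Submodule.mem_sInf.2 fun _ hJ => hJ.1 hx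

lemma isSigmaIdeal_sigmaIdealGen (F : Set R) : IsSigmaIdeal σ (sigmaIdealGen σ F) :=
  fun _ hx => Submodule.mem_sInf.2 fun J hJ => hJ.2 _ (Submodule.mem_sInf.1 hx J hJ)

variable {σ} in
lemma sigmaIdealGen_le {F : Set R} {J : Ideal R} (hF : F ⊆ J) (hJ : IsSigmaIdeal σ J) :
    sigmaIdealGen σ F ≤ J := sInf_le ⟨hF, hJ⟩

lemma subset_rwmClosure (F : Set R) : F ⊆ rwmClosure σ F := fun _ hx =>
  Submodule.mem_sInf.2 fun _ hJ => hJ.1 hx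

lemma isSigmaIdeal_rwmClosure (F : Set R) : IsSigmaIdeal σ (rwmClosure σ F) :=
  fun _ hx => Submodule.mem_sInf.2 fun J hJ => hJ.2.1 _ (Submodule.mem_sInf.1 hx J hJ)

lemma isWellMixed_rwmClosure (F : Set R) : IsWellMixed σ (rwmClosure σ F) :=
  fun _ _ hx => Submodule.mem_sInf.2 fun J hJ => hJ.2.2.1 _ _ (Submodule.mem_sInf.1 hx J hJ)

lemma isRadical_rwmClosure (F : Set R) : (rwmClosure σ F).IsRadical := by
  rintro x ⟨k, hk⟩
  exact Submodule.mem_sInf.2 fun J hJ => hJ.2.2.2 ⟨k, Submodule.mem_sInf.1 hk J hJ⟩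

variable {σ} in
lemma rwmClosure_le {F : Set R} {J : Ideal R} (hF : F ⊆ J) (h₁ : IsSigmaIdeal σ J)
    (h₂ : IsWellMixed σ J) (h₃ : J.IsRadical) : rwmClosure σ F ≤ J :=
  sInf_le ⟨hF, h₁, h₂, h₃⟩

lemma rwmClosure_mono {F G : Set R} (hFG : F ⊆ G) : rwmClosure σ F ≤ rwmClosure σ G :=
  rwmClosure_le (hFG.trans (subset_rwmClosure σ G)) (isSigmaIdeal_rwmClosure σ G)
    (isWellMixed_rwmClosure σ G) (isRadical_rwmClosure σ G)

/-- The quotient ideal `J : z`. -/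
def colonElem (J : Ideal R) (z : R) : Ideal R := Submodule.comap (LinearMap.mulLeft R z) J

lemma mem_colonElem {J : Ideal R} {z x : R} : x ∈ colonElem J z ↔ z * x ∈ J := Iff.rfl

lemma isSigmaIdeal_colonElem {J : Ideal R} (h : IsWellMixed σ J) (z : R) :
    IsSigmaIdeal σ (colonElem J z) := fun x hx => h z x hx

lemma isWellMixed_colonElem {J : Ideal R} (h : IsWellMixed σ J) (z : R) :
    IsWellMixed σ (colonElem J z) := fun x y hx => by
  rw [mem_colonElem, ← mul_assoc] at hx ⊢
  exact h _ _ hx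

lemma isRadical_colonElem {J : Ideal R} (h : J.IsRadical) (z : R) :
    (colonElem J z).IsRadical := by
  rintro x ⟨k, hk⟩
  refine h ⟨k + 1, ?_⟩
  convert J.mul_mem_left (z ^ k * x) (mem_colonElem.1 hk) using 1
  rw [LinearMap.mulLeft_apply]
  ring

variable {σ} in
lemma rwmClosure_le_colonElem_rwmClosure {F G : Set R} {z : R}
    (h : ∀ x ∈ F, z * x ∈ rwmClosure σ G) :
    rwmClosure σ F ≤ colonElem (rwmClosure σ G) z :=
  rwmClosure_le h (isSigmaIdeal_colonElem σ (isWellMixed_rwmClosure σ G) z)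
    (isWellMixed_colonElem σ (isWellMixed_rwmClosure σ G) z)
    (isRadical_colonElem (isRadical_rwmClosure σ G) z)

variable {σ} in
/-- An element `x` of `⟨F ∪ {y}⟩_r` may replace a factor `y`. -/
lemma mul_mem_rwmClosure_of_mem_insert {F : Set R} {x y z : R}
    (hx : x ∈ rwmClosure σ (F ∪ {y})) (hz : z * y ∈ rwmClosure σ F) :
    z * x ∈ rwmClosure σ F := by
  refine rwmClosure_le_colonElem_rwmClosure (G := F) (z := z) ?_ hx
  rintro w (hw | rfl)
  · exact Ideal.mul_mem_left _ _ (subset_rwmClosure σ F hw)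
  · exact hz

variable {σ} in
lemma mul_pow_mem_rwmClosure {F : Set R} {x y : R} (hx : x ∈ rwmClosure σ (F ∪ {y})) (k : ℕ) :
    ∀ {z : R}, z * y ^ k ∈ rwmClosure σ F → z * x ^ k ∈ rwmClosure σ F := by
  induction k with
  | zero => intro z hz; simpa using hz
  | succ k ih =>
    intro z hz
    have h₁ : z * y ^ k * x ∈ rwmClosure σ F :=
      mul_mem_rwmClosure_of_mem_insert hx (by rwa [mul_assoc, ← pow_succ])
    have h₂ : z * x * x ^ k ∈ rwmClosure σ F := ih (by convert h₁ using 1; ring)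
    convert h₂ using 1
    ring

variable {σ} in
lemma mem_rwmClosure_of_prod_pow_mul_mem {ι : Type*} {F : Set R} {x : R} (s : Finset ι)
    (y : ι → R) (e : ι → ℕ) (hx : ∀ v ∈ s, x ∈ rwmClosure σ (F ∪ {y v}))
    (h : (∏ v ∈ s, y v ^ e v) * x ∈ rwmClosure σ F) : x ∈ rwmClosure σ F := by
  suffices ∀ z : R, z * ∏ v ∈ s, y v ^ e v ∈ rwmClosure σ F →
      z * ∏ v ∈ s, x ^ e v ∈ rwmClosure σ F by
    have := this x (by rwa [mul_comm])
    rw [Finset.prod_pow_eq_pow_sum, ← pow_succ'] at this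
    exact isRadical_rwmClosure σ F ⟨_, this⟩
  clear h
  classical
  induction s using Finset.induction_on with
  | empty => intro z hz; simpa using hz
  | insert v s hv ih =>
    intro z hz
    rw [Finset.prod_insert hv] at hz ⊢
    have h₁ := mul_pow_mem_rwmClosure (hx v (by simp)) (e v)
      (z := z * ∏ w ∈ s, y w ^ e w) (by convert hz using 1; ring)
    have h₂ := ih (fun w hw => hx w (by simp [hw])) (z * x ^ e v) (by convert h₁ using 1; ring)
    convert h₂ using 1
    ring

end RadicalWellMixed

section Monomials

variable {K : Type*} [Field K] {n : ℕ} (σK : K →+* K)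

lemma shift_X (v : Fin n × ℕ) :
    shift σK (MvPolynomial.X v) = MvPolynomial.X (v.1, v.2 + 1) := by
  simp [shift]

lemma shift_iterate_X (i : Fin n) (k : ℕ) :
    (⇑(shift σK))^[k] (MvPolynomial.X (i, 0)) = MvPolynomial.X (i, k) := by
  induction k with
  | zero => rfl
  | succ k ih => rw [Function.iterate_succ_apply', ih, shift_X]

lemma shift_monomial_one (u : Fin n × ℕ →₀ ℕ) :
    ∃ u', shift σK (MvPolynomial.monomial u 1) = MvPolynomial.monomial u' 1 := by
  induction u using Finsupp.induction_linear with
  | zero => exact ⟨0, map_one _⟩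
  | add u w hu hw =>
    obtain ⟨u', hu⟩ := hu
    obtain ⟨w', hw⟩ := hw
    refine ⟨u' + w', ?_⟩
    rw [← one_mul (1 : K), ← MvPolynomial.monomial_mul, map_mul, hu, hw,
      MvPolynomial.monomial_mul]
  | single v k =>
    refine ⟨Finsupp.single (v.1, v.2 + 1) k, ?_⟩
    rw [← MvPolynomial.X_pow_eq_monomial, map_pow, shift_X, MvPolynomial.X_pow_eq_monomial]

lemma varPow_eq_X (i : Fin n) (k : ℕ) :
    varPow σK i k = (MvPolynomial.X (i, k) : DPoly K n) := by
  rw [varPow, ypow, sexp, Polynomial.natDegree_X_pow, Finset.prod_eq_single k]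
  · simp [shift_iterate_X]
  · intro m _ hm
    simp [Polynomial.coeff_X_pow, hm]
  · simp

/-- The exponent vector of the monomial `Y^f`. -/
noncomputable def exponentOf (f : Fin n → Polynomial ℕ) : Fin n × ℕ →₀ ℕ :=
  ∑ i, ∑ k ∈ Finset.range ((f i).natDegree + 1), Finsupp.single (i, k) ((f i).coeff k)

lemma exponentOf_apply (f : Fin n → Polynomial ℕ) (v : Fin n × ℕ) :
    exponentOf f v = (f v.1).coeff v.2 := by
  classical
  obtain ⟨i, k⟩ := v
  rw [exponentOf, Finsupp.finsetSum_apply, Finset.sum_eq_single i]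
  · rw [Finsupp.finsetSum_apply, Finset.sum_eq_single k]
    · simp
    · intro m _ hm
      simp [hm]
    · intro hk
      simpa using Polynomial.coeff_eq_zero_of_natDegree_lt (by simpa using hk)
  · intro m _ hm
    simp [Finsupp.finsetSum_apply, hm]
  · simp

lemma monom_eq_monomial (f : Fin n → Polynomial ℕ) :
    monom σK f = MvPolynomial.monomial (exponentOf f) (1 : K) := by
  simp only [monom, ypow, sexp, shift_iterate_X, exponentOf, MvPolynomial.monomial_sum_one,
    MvPolynomial.X_pow_eq_monomial]

lemma exists_exponentOf_eq (u : Fin n × ℕ →₀ ℕ) : ∃ f, exponentOf f = u := by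
  classical
  refine ⟨fun i => ∑ v ∈ u.support, if v.1 = i then Polynomial.monomial v.2 (u v) else 0, ?_⟩
  ext ⟨i, k⟩
  rw [exponentOf_apply]
  simp only [Polynomial.finsetSum_coeff]
  rw [Finset.sum_eq_single (i, k)]
  · simp
  · rintro ⟨i', k'⟩ _ hv
    by_cases h : i' = i
    · subst h
      have : k' ≠ k := fun h => hv (by rw [h])
      simp [Polynomial.coeff_monomial, this]
    · simp [h]
  · intro h
    simpa using h

lemma isPureBinomial_iff {p : DPoly K n} : IsPureBinomial σK p ↔
    ∃ u w, p = MvPolynomial.monomial u 1 - MvPolynomial.monomial w 1 := by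
  simp only [IsPureBinomial, monom_eq_monomial]
  constructor
  · rintro ⟨f, g, rfl⟩
    exact ⟨_, _, rfl⟩
  · rintro ⟨u, w, rfl⟩
    obtain ⟨f, rfl⟩ := exists_exponentOf_eq u
    obtain ⟨g, rfl⟩ := exists_exponentOf_eq w
    exact ⟨f, g, rfl⟩

lemma IsPureBinomial.shift {p : DPoly K n} (hp : IsPureBinomial σK p) :
    IsPureBinomial σK (shift σK p) := by
  rw [isPureBinomial_iff] at hp ⊢
  obtain ⟨u, w, rfl⟩ := hp
  obtain ⟨u', hu⟩ := shift_monomial_one σK u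
  obtain ⟨w', hw⟩ := shift_monomial_one σK w
  exact ⟨u', w', by rw [map_sub, hu, hw]⟩

variable {t : ℕ} (j : Fin t → Fin n) (a : Fin t → ℕ)

lemma mem_Tset_iff {M : DPoly K n} : M ∈ Tset σK j a ↔
    ∃ u : Fin n × ℕ →₀ ℕ, (∀ i k, a i ≤ k → u (j i, k) = 0) ∧ M = MvPolynomial.monomial u 1 := by
  simp only [Tset, Set.mem_ofPred_eq, monom_eq_monomial, Polynomial.degree_lt_iff_coeff_zero]
  constructor
  · rintro ⟨f, hf, rfl⟩
    exact ⟨_, fun i k hk => by rw [exponentOf_apply]; exact hf i k hk, rfl⟩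
  · rintro ⟨u, hu, rfl⟩
    obtain ⟨f, rfl⟩ := exists_exponentOf_eq u
    exact ⟨f, fun i k hk => by simpa [exponentOf_apply] using hu i k hk, rfl⟩

lemma one_mem_Tset : (1 : DPoly K n) ∈ Tset σK j a :=
  (mem_Tset_iff σK j a).2 ⟨0, fun _ _ _ => rfl, rfl⟩

variable {σK j a} in
lemma mul_mem_Tset {M N : DPoly K n} (hM : M ∈ Tset σK j a) (hN : N ∈ Tset σK j a) :
    M * N ∈ Tset σK j a := by
  rw [mem_Tset_iff] at *
  obtain ⟨u, hu, rfl⟩ := hM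
  obtain ⟨w, hw, rfl⟩ := hN
  exact ⟨u + w, fun i k hk => by simp [hu i k hk, hw i k hk], by simp [MvPolynomial.monomial_mul]⟩

variable {j a} in
lemma ne_or_lt_of_mem_support {u : Fin n × ℕ →₀ ℕ} (hu : ∀ i k, a i ≤ k → u (j i, k) = 0)
    {v : Fin n × ℕ} (hv : v ∈ u.support) :
    (∀ m, v.1 ≠ j m) ∨ ∃ m, v.1 = j m ∧ v.2 < a m := by
  by_contra! hc
  obtain ⟨⟨m, hm⟩, hlt⟩ := hc
  refine Finsupp.mem_support_iff.1 hv ?_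
  rw [← hu m v.2 (hlt m hm), ← hm]

end Monomials

section Congruence

variable {K : Type*} [Field K] {ι : Type*}

/-- The congruence on exponent vectors determined by the pure binomials in an ideal. -/
noncomputable def binomialCon (Q : Ideal (MvPolynomial ι K)) : AddCon (ι →₀ ℕ) where
  r u w := MvPolynomial.monomial u (1 : K) - MvPolynomial.monomial w 1 ∈ Q
  iseqv := ⟨fun u => by simp, fun {u w} h => by rw [← neg_sub]; exact Q.neg_mem h,
    fun {u w x} h₁ h₂ => by simpa using Q.add_mem h₁ h₂⟩
  add' {u w x y} h₁ h₂ := by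
    have := Q.add_mem (Q.mul_mem_right (MvPolynomial.monomial x 1) h₁)
      (Q.mul_mem_left (MvPolynomial.monomial w 1) h₂)
    simpa [sub_mul, mul_sub, MvPolynomial.monomial_mul] using this

lemma binomialCon_iff {Q : Ideal (MvPolynomial ι K)} {u w : ι →₀ ℕ} : binomialCon Q u w ↔
    MvPolynomial.monomial u (1 : K) - MvPolynomial.monomial w 1 ∈ Q := Iff.rfl

variable (Q : Ideal (MvPolynomial ι K))

/-- The ideal generated by the pure binomials in `Q`. -/
noncomputable def binomialPart : Ideal (MvPolynomial ι K) :=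
  Ideal.span {p | p ∈ Q ∧ ∃ u w, p = MvPolynomial.monomial u 1 - MvPolynomial.monomial w 1}

/-- The projection onto the monoid algebra of the quotient by `binomialCon Q`. -/
noncomputable def binomialQuotientMap :
    MvPolynomial ι K →+* AddMonoidAlgebra K (binomialCon Q).Quotient :=
  AddMonoidAlgebra.mapDomainRingHom K (binomialCon Q).mk'

lemma binomialQuotientMap_monomial (u : ι →₀ ℕ) (r : K) :
    binomialQuotientMap Q (MvPolynomial.monomial u r) =
      AddMonoidAlgebra.single (u : (binomialCon Q).Quotient) r :=
  AddMonoidAlgebra.mapDomain_single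

lemma ker_binomialQuotientMap : RingHom.ker (binomialQuotientMap Q) = binomialPart Q := by
  apply le_antisymm
  · let r : (binomialCon Q).Quotient → (ι →₀ ℕ) := Quotient.out
    have key : ∀ p : MvPolynomial ι K,
        p - AddMonoidAlgebra.mapDomain r (binomialQuotientMap Q p) ∈ binomialPart Q := by
      intro p
      induction p using MvPolynomial.induction_on' with
      | monomial u b =>
        rw [binomialQuotientMap_monomial, AddMonoidAlgebra.mapDomain_single]
        have h₁ : MvPolynomial.monomial u (1 : K) - MvPolynomial.monomial (r u) 1 ∈ Q :=
          (binomialCon Q).symm ((binomialCon Q).eq.1 (Quotient.out_eq _))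
        have h₂ := (binomialPart Q).mul_mem_left (MvPolynomial.C b)
          (Ideal.subset_span ⟨h₁, u, r u, rfl⟩)
        rw [mul_sub, MvPolynomial.C_mul_monomial, MvPolynomial.C_mul_monomial, mul_one] at h₂
        exact h₂
      | add p q hp hq =>
        rw [map_add, AddMonoidAlgebra.mapDomain_add, add_sub_add_comm]
        exact Ideal.add_mem _ hp hq
    intro p hp
    have := key p
    rw [RingHom.mem_ker.1 hp] at this
    simpa using this
  · refine Ideal.span_le.2 ?_
    rintro p ⟨hp, u, w, rfl⟩
    rw [SetLike.mem_coe, RingHom.mem_ker, map_sub, binomialQuotientMap_monomial,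
      binomialQuotientMap_monomial, (binomialCon Q).eq.2 hp, sub_self]

variable {Q} in
lemma mem_binomialPart_of_monomial_mul_mem {m : ι →₀ ℕ}
    (hm : ∀ g, MvPolynomial.monomial m 1 * g ∈ Q → g ∈ Q) {g : MvPolynomial ι K}
    (hg : MvPolynomial.monomial m 1 * g ∈ binomialPart Q) : g ∈ binomialPart Q := by
  rw [← ker_binomialQuotientMap, RingHom.mem_ker] at hg ⊢
  rw [map_mul, binomialQuotientMap_monomial] at hg
  have hinj : ∀ x y : (binomialCon Q).Quotient, (m : (binomialCon Q).Quotient) + x = m + y →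
      x = y := by
    intro x y
    induction x, y using AddCon.induction_on₂ with
    | H u w =>
      intro h
      rw [← AddCon.coe_add, ← AddCon.coe_add, AddCon.eq, binomialCon_iff] at h
      rw [AddCon.eq, binomialCon_iff]
      exact hm _ (by simpa [mul_sub, MvPolynomial.monomial_mul] using h)
  ext x
  have := AddMonoidAlgebra.coeff_single_mul_eq_mul_coeff (x := binomialQuotientMap Q g)
    (m := (m : (binomialCon Q).Quotient)) (r := (1 : K)) (m₁ := m + x) x
    (fun y _ => ⟨hinj y x, fun h => by rw [h]⟩)
  rw [hg] at this
  simpa using this.symm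

end Congruence

section Saturation

variable {K : Type*} [Field K] {n t : ℕ} (σK : K →+* K) (j : Fin t → Fin n) (a : Fin t → ℕ)

/-- The quotient of an ideal by the multiplicative set `Tset`, as an ideal. -/
def colonTIdeal (J : Ideal (DPoly K n)) : Ideal (DPoly K n) where
  carrier := colonT σK j a J
  zero_mem' := ⟨1, one_mem_Tset σK j a, by simp⟩
  add_mem' := by
    rintro x y ⟨M, hM, hx⟩ ⟨N, hN, hy⟩
    refine ⟨M * N, mul_mem_Tset hM hN, ?_⟩
    convert J.add_mem (J.mul_mem_left N hx) (J.mul_mem_left M hy) using 1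
    ring
  smul_mem' := by
    rintro c x ⟨M, hM, hx⟩
    refine ⟨M, hM, ?_⟩
    convert J.mul_mem_left c hx using 1
    rw [smul_eq_mul]
    ring

variable {σK j a}

lemma mem_colonTIdeal {J : Ideal (DPoly K n)} {x : DPoly K n} :
    x ∈ colonTIdeal σK j a J ↔ ∃ M ∈ Tset σK j a, M * x ∈ J := Iff.rfl

lemma saturatedWrt_colonTIdeal (J : Ideal (DPoly K n)) :
    SaturatedWrt σK j a (colonTIdeal σK j a J) := by
  rintro g M hM ⟨N, hN, hg⟩
  exact ⟨N * M, mul_mem_Tset hN hM, by rwa [mul_assoc]⟩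

lemma isSigmaIdeal_colonTIdeal {J : Ideal (DPoly K n)} (hJ : IsWellMixed (shift σK) J) :
    IsSigmaIdeal (shift σK) (colonTIdeal σK j a J) := by
  rintro g ⟨M, hM, hg⟩
  exact ⟨M, hM, hJ _ _ hg⟩

lemma SaturatedWrt.binomialPart {Q : Ideal (DPoly K n)} (hQ : SaturatedWrt σK j a Q) :
    SaturatedWrt σK j a (binomialPart Q) := by
  intro g M hM hg
  obtain ⟨u, -, rfl⟩ := (mem_Tset_iff σK j a).1 hM
  exact mem_binomialPart_of_monomial_mul_mem (fun x hx => hQ x _ hM hx) hg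

lemma IsSigmaIdeal.binomialPart {Q : Ideal (DPoly K n)} (hQ : IsSigmaIdeal (shift σK) Q) :
    IsSigmaIdeal (shift σK) (binomialPart Q) := by
  have : _root_.binomialPart Q ≤ (_root_.binomialPart Q).comap (shift σK) := by
    refine Ideal.span_le.2 ?_
    rintro p ⟨hp, hpure⟩
    exact Ideal.subset_span ⟨hQ _ hp, (isPureBinomial_iff σK).1
      (((isPureBinomial_iff σK).2 hpure).shift)⟩
  exact this

/-- An element of the saturated closure of a pure binomial σ-ideal lies in the ideal generated by
the pure binomials that a single monomial of `Tset` carries into a well-mixed ideal. -/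
lemma exists_mem_span_of_mem_Nclosure {I J : Ideal (DPoly K n)}
    (hI : IsPureBinomialSigmaIdeal σK I) (hIJ : I ≤ J) (hJ : IsWellMixed (shift σK) J)
    {h : DPoly K n} (hh : h ∈ Nclosure σK j a I) :
    ∃ M ∈ Tset σK j a, h ∈ Ideal.span {p | IsPureBinomial σK p ∧ M * p ∈ J} := by
  obtain ⟨S, hS, rfl⟩ := hI
  have hsig := isSigmaIdeal_colonTIdeal (j := j) (a := a) hJ
  have hmem : h ∈ binomialPart (colonTIdeal σK j a J) := by
    refine Submodule.mem_sInf.1 hh _ ⟨sigmaIdealGen_le ?_ hsig.binomialPart, hsig.binomialPart,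
      (saturatedWrt_colonTIdeal J).binomialPart⟩
    exact fun p hp => Ideal.subset_span ⟨⟨1, one_mem_Tset σK j a, by
      rw [one_mul]; exact hIJ (subset_sigmaIdealGen _ _ hp)⟩, (isPureBinomial_iff σK).1 (hS p hp)⟩
  have hmono : ∀ {M N : DPoly K n}, M ∣ N →
      Ideal.span {p | IsPureBinomial σK p ∧ M * p ∈ J} ≤
        Ideal.span {p | IsPureBinomial σK p ∧ N * p ∈ J} := by
    rintro M _ ⟨c, rfl⟩
    refine Ideal.span_mono fun p hp => ⟨hp.1, ?_⟩
    convert J.mul_mem_left c hp.2 using 1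
    ring
  clear hh
  unfold binomialPart at hmem
  induction hmem using Submodule.span_induction with
  | mem p hp =>
    obtain ⟨⟨M, hM, hp⟩, hpure⟩ := hp
    exact ⟨M, hM, Ideal.subset_span ⟨(isPureBinomial_iff σK).2 hpure, hp⟩⟩
  | zero => exact ⟨1, one_mem_Tset σK j a, Ideal.zero_mem _⟩
  | add x y _ _ hx hy =>
    obtain ⟨M, hM, hx⟩ := hx
    obtain ⟨N, hN, hy⟩ := hy
    exact ⟨M * N, mul_mem_Tset hM hN, Ideal.add_mem _ (hmono (dvd_mul_right _ _) hx)
      (hmono (dvd_mul_left _ _) hy)⟩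
  | smul c x _ hx =>
    obtain ⟨M, hM, hx⟩ := hx
    exact ⟨M, hM, Ideal.mul_mem_left _ c hx⟩

end Saturation

/-- For `h ∈ N(I)`, there is a pure binomial σ-ideal `I' ⊇ [I ∪ {h}]` with
`⟨I ∪ {vars}⟩_r = ⟨I' ∪ {vars}⟩_r ∩ ⋂_k ⟨I ∪ {vars} ∪ {y_{p_k}^{x^{b_k}}}⟩_r`. -/
theorem stmt8 {K : Type*} [Field K] [CharZero K] {n t : ℕ} (σK : K →+* K)
    (j : Fin t → Fin n) (hj : Function.Injective j) (a : Fin t → ℕ)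
    (I : Ideal (DPoly K n)) (hI : IsPureBinomialSigmaIdeal σK I)
    (h : DPoly K n) (hh : h ∈ Nclosure σK j a I) :
    ∃ I' : Ideal (DPoly K n), IsPureBinomialSigmaIdeal σK I' ∧
      sigmaIdealGen (shift σK) ((I : Set (DPoly K n)) ∪ {h}) ≤ I' ∧
      ∃ (l : ℕ) (p : Fin l → Fin n) (b : Fin l → ℕ),
        (∀ k : Fin l, (∀ m : Fin t, p k ≠ j m) ∨ ∃ m : Fin t, p k = j m ∧ b k < a m) ∧
        rwmClosure (shift σK) ((I : Set (DPoly K n)) ∪ varSet σK j a) =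
          rwmClosure (shift σK) ((I' : Set (DPoly K n)) ∪ varSet σK j a) ⊓
            ⨅ k : Fin l, rwmClosure (shift σK)
              ((I : Set (DPoly K n)) ∪ varSet σK j a ∪ {varPow σK (p k) (b k)}) := by
  set F : Set (DPoly K n) := (I : Set (DPoly K n)) ∪ varSet σK j a with hF
  have hIF : I ≤ rwmClosure (shift σK) F := fun x hx => subset_rwmClosure _ _ (Or.inl hx)
  obtain ⟨M, hM, hspan⟩ :=
    exists_mem_span_of_mem_Nclosure hI hIF (isWellMixed_rwmClosure (shift σK) F) hh
  obtain ⟨u, hu, rfl⟩ := (mem_Tset_iff σK j a).1 hM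
  set B : Set (DPoly K n) :=
    {p | IsPureBinomial σK p ∧ MvPolynomial.monomial u 1 * p ∈ rwmClosure (shift σK) F} with hB
  have hII' : I ≤ sigmaIdealGen (shift σK) B := by
    obtain ⟨S, hS, rfl⟩ := hI
    refine sigmaIdealGen_le (fun p hp => subset_sigmaIdealGen _ _ ⟨hS p hp, ?_⟩)
      (isSigmaIdeal_sigmaIdealGen _ _)
    exact Ideal.mul_mem_left _ _ (hIF (subset_sigmaIdealGen _ _ hp))
  have hhI' : h ∈ sigmaIdealGen (shift σK) B :=
    Ideal.span_le.2 (subset_sigmaIdealGen (shift σK) B) hspan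
  refine ⟨sigmaIdealGen (shift σK) B, ⟨B, fun p hp => hp.1, rfl⟩,
    sigmaIdealGen_le (Set.union_subset hII' (Set.singleton_subset_iff.2 hhI'))
      (isSigmaIdeal_sigmaIdealGen _ _),
    u.support.card, fun k => (u.support.equivFin.symm k).1.1,
    fun k => (u.support.equivFin.symm k).1.2,
    fun k => ne_or_lt_of_mem_support hu (u.support.equivFin.symm k).2, ?_⟩
  apply le_antisymm
  · exact le_inf (rwmClosure_mono _ (Set.union_subset_union_left _ hII'))
      (le_iInf fun k => rwmClosure_mono _ Set.subset_union_left)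
  · rintro x ⟨hx₁, hx₂⟩
    have hx₂ := (Submodule.mem_iInf _).1 hx₂
    refine mem_rwmClosure_of_prod_pow_mul_mem u.support MvPolynomial.X u (fun v hv => ?_) ?_
    · simpa [varPow_eq_X] using hx₂ (u.support.equivFin ⟨v, hv⟩)
    · rw [MvPolynomial.prod_X_pow_eq_monomial]
      refine rwmClosure_le_colonElem_rwmClosure ?_ hx₁
      rintro w (hw | hw)
      · exact sigmaIdealGen_le (fun p hp => hp.2) (isSigmaIdeal_colonElem _
          (isWellMixed_rwmClosure _ _) _) hw
      · exact Ideal.mul_mem_left _ _ (subset_rwmClosure _ _ (Or.inr hw))
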